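/- arXiv:0804.4774 — 2 statements merged into one kernel-verified Lean document; each statement's English description precedes it below -/
import Mathlib

section
/- (Zhang–Yeung inequality, the s = 2 instance of the family derived by projecting H₅ ∩ C₅.) For any four jointly distributed discrete random variables X₁, X₂, X₃, X₄ with finite entropies: −2·H(1) − 2·H(2) − H(3) + 3·H(12) + 3·H(13) + 3·H(23) + H(14) + H(24) − H(34) − 4·H(123) − H(124) ≥ 0. -/
open MeasureTheory

/-- The Shannon entropy of a random variable `X` taking values in a finite set,
computed from the distribution of `X` under the measure `μ`. -/
noncomputable def shannonEntropy {Ω : Type*} [MeasurableSpace Ω] (μ : Measure Ω)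
    {β : Type*} [Fintype β] (X : Ω → β) : ℝ :=
  ∑ b : β, Real.negMulLog ((μ (X ⁻¹' {b})).toReal)

/-- Subadditivity of entropy for an unnormalised joint weight `r` on `A × B`. -/
lemma negMulLog_sum_add_sum_negMulLog_le {A B : Type*} [Fintype A] [Fintype B]
    (r : A → B → ℝ) (hr : ∀ a b, 0 ≤ r a b) :
    Real.negMulLog (∑ a, ∑ b, r a b) + ∑ a, ∑ b, Real.negMulLog (r a b) ≤
      ∑ a, Real.negMulLog (∑ b, r a b) + ∑ b, Real.negMulLog (∑ a, r a b) := by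
  set R : A → ℝ := fun a => ∑ b, r a b with hR
  set C : B → ℝ := fun b => ∑ a, r a b with hC
  set S : ℝ := ∑ a, R a with hS
  have hSC : ∑ b, C b = S := Finset.sum_comm
  have hR0 : ∀ a, 0 ≤ R a := fun a => Finset.sum_nonneg fun b _ => hr a b
  have hC0 : ∀ b, 0 ≤ C b := fun b => Finset.sum_nonneg fun a _ => hr a b
  have hS0 : 0 ≤ S := Finset.sum_nonneg fun a _ => hR0 a
  have key : ∀ a b, r a b * (Real.log (R a) + Real.log (C b) - Real.log S - Real.log (r a b)) ≤
      R a * C b / S - r a b := by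
    intro a b
    rcases (hr a b).eq_or_lt with h | h
    · rw [← h]
      have := div_nonneg (mul_nonneg (hR0 a) (hC0 b)) hS0
      simpa using this
    · have h1 : 0 < R a :=
        h.trans_le (Finset.single_le_sum (fun b _ => hr a b) (Finset.mem_univ b))
      have h2 : 0 < C b :=
        h.trans_le (Finset.single_le_sum (f := fun a => r a b) (fun a _ => hr a b)
          (Finset.mem_univ a))
      have h3 : 0 < S := h1.trans_le (Finset.single_le_sum (fun a _ => hR0 a) (Finset.mem_univ a))
      have h4 := Real.log_le_sub_one_of_pos (x := R a * C b / (S * r a b)) (by positivity)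
      rw [Real.log_div (by positivity) (by positivity), Real.log_mul h1.ne' h2.ne',
        Real.log_mul h3.ne' h.ne'] at h4
      calc _ ≤ r a b * (R a * C b / (S * r a b) - 1) :=
            mul_le_mul_of_nonneg_left (by linarith) h.le
        _ = _ := by field_simp
  have hsum := Finset.sum_le_sum fun a (_ : a ∈ Finset.univ) =>
    Finset.sum_le_sum fun b (_ : b ∈ Finset.univ) => key a b
  have hright : ∑ a, ∑ b, (R a * C b / S - r a b) = 0 := by
    have : ∑ a, ∑ b, R a * C b / S = S * S / S := by
      simp_rw [← Finset.sum_div, ← Finset.mul_sum, hSC, ← Finset.sum_mul, ← hS]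
    simp_rw [Finset.sum_sub_distrib]
    rw [this, mul_self_div_self]
    exact sub_self S
  have hleft : ∑ a, ∑ b, r a b *
      (Real.log (R a) + Real.log (C b) - Real.log S - Real.log (r a b)) =
      ∑ a, R a * Real.log (R a) + ∑ b, C b * Real.log (C b) - S * Real.log S -
        ∑ a, ∑ b, r a b * Real.log (r a b) := by
    simp_rw [mul_sub, mul_add, Finset.sum_sub_distrib, Finset.sum_add_distrib, ← Finset.sum_mul]
    rw [Finset.sum_comm (f := fun a b => r a b * Real.log (C b))]
    simp_rw [← Finset.sum_mul]
    rfl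
  simp only [Real.negMulLog, neg_mul, Finset.sum_neg_distrib]
  linarith

open Classical in
/-- The push-forward of a weight `q` on a finite type along `f`. -/
noncomputable def marginal {W β : Type*} [Fintype W] (q : W → ℝ) (f : W → β) (b : β) : ℝ :=
  ∑ w, if f w = b then q w else 0

/-- The entropy of `f` under a weight `q` on a finite type. -/
noncomputable def weightEntropy {W β : Type*} [Fintype W] [Fintype β] (q : W → ℝ) (f : W → β) :
    ℝ :=
  ∑ b, Real.negMulLog (marginal q f b)

section

variable {W A B C D β : Type*} [Fintype W]

lemma marginal_nonneg {q : W → ℝ} (hq : ∀ w, 0 ≤ q w) (f : W → β) (b : β) :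
    0 ≤ marginal q f b :=
  Finset.sum_nonneg fun w _ => by split_ifs <;> simp [hq]

lemma le_marginal {q : W → ℝ} (hq : ∀ w, 0 ≤ q w) (f : W → β) (w : W) :
    q w ≤ marginal q f (f w) := by
  classical
  have := Finset.single_le_sum (f := fun w' => if f w' = f w then q w' else 0)
    (fun w' _ => by split_ifs <;> simp [hq]) (Finset.mem_univ w)
  simpa [marginal] using this

lemma sum_marginal_mul [Fintype β] (q : W → ℝ) (f : W → β) (φ : β → ℝ) :
    ∑ b, marginal q f b * φ b = ∑ w, q w * φ (f w) := by
  classical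
  simp_rw [marginal, Finset.sum_mul]
  rw [Finset.sum_comm]
  simp [ite_mul]

lemma marginal_comp [Fintype A] (q : W → ℝ) (f : W → A) (k : A → B) :
    marginal q (fun w => k (f w)) = marginal (marginal q f) k := by
  classical
  ext b
  have := sum_marginal_mul q f fun a => if k a = b then 1 else 0
  simpa [marginal] using this.symm

lemma marginal_id (q : W → ℝ) : marginal q (fun w => w) = q := by
  classical
  ext w
  simp [marginal]

lemma weightEntropy_eq_neg_sum [Fintype β] (q : W → ℝ) (f : W → β) :
    weightEntropy q f = -∑ w, q w * Real.log (marginal q f (f w)) := by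
  rw [← sum_marginal_mul q f fun b => Real.log (marginal q f b)]
  simp [weightEntropy, Real.negMulLog]

lemma weightEntropy_congr [Fintype A] [Fintype B] (q : W → ℝ) {f : W → A} {g : W → B}
    (h : ∀ w w', f w = f w' ↔ g w = g w') : weightEntropy q f = weightEntropy q g := by
  classical
  have key : ∀ w, marginal q f (f w) = marginal q g (g w) := fun w =>
    Finset.sum_congr rfl fun w' _ => if_congr (h w' w) rfl rfl
  simp only [weightEntropy_eq_neg_sum, key]

lemma marginal_eq_sum_pair [Fintype A] (q : W → ℝ) (f : W → A) (g : W → B) (b : B) :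
    marginal q g b = ∑ a, marginal q (fun w => (f w, g w)) (a, b) := by
  classical
  simp_rw [marginal, Prod.mk.injEq]
  rw [Finset.sum_comm]
  simp [ite_and]

/-- Submodularity of entropy: conditional mutual information is nonnegative. -/
lemma weightEntropy_pair_submodular [Fintype A] [Fintype B] [Fintype C]
    {q : W → ℝ} (hq : ∀ w, 0 ≤ q w) (f : W → A) (g : W → B) (h : W → C) :
    weightEntropy q h + weightEntropy q (fun w => (f w, g w, h w)) ≤
      weightEntropy q (fun w => (f w, h w)) + weightEntropy q (fun w => (g w, h w)) := by
  set r := marginal q (fun w => (f w, g w, h w)) with hr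
  have h1 : ∀ b c, marginal q (fun w => (g w, h w)) (b, c) = ∑ a, r (a, b, c) := fun b c =>
    marginal_eq_sum_pair q f (fun w => (g w, h w)) (b, c)
  have h2 : ∀ a c, marginal q (fun w => (f w, h w)) (a, c) = ∑ b, r (a, b, c) := by
    classical
    intro a c
    rw [marginal_eq_sum_pair q g (fun w => (f w, h w)) (a, c)]
    simp only [hr, marginal, Prod.mk.injEq, and_left_comm]
  have h3 : ∀ c, marginal q h c = ∑ a, ∑ b, r (a, b, c) := fun c => by
    rw [marginal_eq_sum_pair q f h]
    exact Finset.sum_congr rfl fun a _ => h2 a c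
  have key := Finset.sum_le_sum fun c (_ : c ∈ Finset.univ) =>
    negMulLog_sum_add_sum_negMulLog_le (fun a b => r (a, b, c))
      fun a b => marginal_nonneg hq _ _
  simp_rw [Finset.sum_add_distrib, ← h3, ← h1, ← h2] at key
  simp_rw [weightEntropy, Fintype.sum_prod_type]
  have e1 : ∑ c, ∑ a, ∑ b, Real.negMulLog (r (a, b, c)) =
      ∑ a, ∑ b, ∑ c, Real.negMulLog (r (a, b, c)) := by
    rw [Finset.sum_comm]
    exact Finset.sum_congr rfl fun a _ => Finset.sum_comm
  rw [e1] at key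
  rw [Finset.sum_comm (f := fun a c => Real.negMulLog (marginal q (fun w => (f w, h w)) (a, c))),
    Finset.sum_comm (f := fun b c => Real.negMulLog (marginal q (fun w => (g w, h w)) (b, c)))]
  exact key

/-- Submodularity of entropy, for variables `u`, `v`, `t` that carry the same information as
`(f, h)`, `(g, h)` and `(f, g, h)`. -/
lemma weightEntropy_submodular [Fintype A] [Fintype B] [Fintype C]
    {U V T : Type*} [Fintype U] [Fintype V] [Fintype T]
    {q : W → ℝ} (hq : ∀ w, 0 ≤ q w) (f : W → A) (g : W → B) (h : W → C)
    (u : W → U) (v : W → V) (t : W → T)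
    (hu : ∀ w w', u w = u w' ↔ f w = f w' ∧ h w = h w')
    (hv : ∀ w w', v w = v w' ↔ g w = g w' ∧ h w = h w')
    (ht : ∀ w w', t w = t w' ↔ f w = f w' ∧ g w = g w' ∧ h w = h w') :
    weightEntropy q h + weightEntropy q t ≤ weightEntropy q u + weightEntropy q v := by
  have key := weightEntropy_pair_submodular hq f g h
  rwa [weightEntropy_congr q (f := fun w => (f w, h w)) (g := u) fun w w' => by simp [hu],
    weightEntropy_congr q (f := fun w => (g w, h w)) (g := v) fun w w' => by simp [hv],
    weightEntropy_congr q (f := fun w => (f w, g w, h w)) (g := t) fun w w' => by simp [ht]] at key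

/-- The weight on `W × A` adjoining to `q` a copy of `f` that is conditionally independent of
everything given `c`. -/
noncomputable def copyWeight (q : W → ℝ) (f : W → A) (c : W → C) (x : W × A) : ℝ :=
  q x.1 * (marginal q (fun w => (f w, c w)) (x.2, c x.1) / marginal q c (c x.1))

lemma copyWeight_nonneg {q : W → ℝ} (hq : ∀ w, 0 ≤ q w) (f : W → A) (c : W → C) (x : W × A) :
    0 ≤ copyWeight q f c x :=
  mul_nonneg (hq _) (div_nonneg (marginal_nonneg hq _ _) (marginal_nonneg hq _ _))

lemma marginal_copyWeight_fst [Fintype A]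
    {q : W → ℝ} (hq : ∀ w, 0 ≤ q w) (f : W → A) (c : W → C) :
    marginal (copyWeight q f c) Prod.fst = q := by
  classical
  ext w
  have h : marginal (copyWeight q f c) Prod.fst w = ∑ a, copyWeight q f c (w, a) := by
    simp only [marginal, Fintype.sum_prod_type]
    rw [Finset.sum_comm]
    simp
  rw [h]
  simp only [copyWeight, ← Finset.mul_sum, ← Finset.sum_div, ← marginal_eq_sum_pair]
  rcases (hq w).eq_or_lt with h0 | h0
  · simp [← h0]
  · rw [div_self (h0.trans_le (le_marginal hq c w)).ne', mul_one]

lemma marginal_copyWeight_snd [Fintype A]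
    {q : W → ℝ} (hq : ∀ w, 0 ≤ q w) (f : W → A) (c : W → C) :
    marginal (copyWeight q f c) (fun x => (x.2, c x.1)) = marginal q (fun w => (f w, c w)) := by
  classical
  ext ⟨a, d⟩
  have h : marginal (copyWeight q f c) (fun x => (x.2, c x.1)) (a, d) =
      marginal q c d * (marginal q (fun w => (f w, c w)) (a, d) / marginal q c d) := by
    set m := marginal q (fun w => (f w, c w)) (a, d) / marginal q c d with hm
    rw [marginal, marginal, Fintype.sum_prod_type, Finset.sum_mul]
    refine Finset.sum_congr rfl fun w _ => ?_
    by_cases hc : c w = d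
    · simp [copyWeight, hc, hm]
    · simp [hc]
  rw [h]
  rcases eq_or_ne (marginal q c d) 0 with h0 | h0
  · rw [h0, zero_mul]
    rw [marginal_eq_sum_pair q f c d,
      Finset.sum_eq_zero_iff_of_nonneg fun a _ => marginal_nonneg hq _ _] at h0
    exact (h0 a (Finset.mem_univ a)).symm
  · exact mul_div_cancel₀ _ h0

lemma weightEntropy_copyWeight_fst [Fintype A] [Fintype β]
    {q : W → ℝ} (hq : ∀ w, 0 ≤ q w) (f : W → A) (c : W → C)
    (g : W → β) :
    weightEntropy (copyWeight q f c) (fun x => g x.1) = weightEntropy q g := by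
  rw [weightEntropy, marginal_comp _ Prod.fst g, marginal_copyWeight_fst hq, weightEntropy]

lemma weightEntropy_copyWeight_snd [Fintype A] [Fintype C] [Fintype β]
    {q : W → ℝ} (hq : ∀ w, 0 ≤ q w) (f : W → A) (c : W → C)
    (k : A × C → β) :
    weightEntropy (copyWeight q f c) (fun x => k (x.2, c x.1)) =
      weightEntropy q (fun w => k (f w, c w)) := by
  rw [weightEntropy, marginal_comp _ (fun x : W × A => (x.2, c x.1)) k,
    marginal_copyWeight_snd hq, ← marginal_comp, weightEntropy]

/-- The adjoined copy of `f` is conditionally independent of the original point given `c`. -/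
lemma weightEntropy_copyWeight_id [Fintype A] [Fintype C]
    {q : W → ℝ} (hq : ∀ w, 0 ≤ q w) (f : W → A) (c : W → C) :
    weightEntropy (copyWeight q f c) (fun x => x) + weightEntropy q c =
      weightEntropy q (fun w => w) + weightEntropy q (fun w => (f w, c w)) := by
  rw [← weightEntropy_copyWeight_fst hq f c c, ← weightEntropy_copyWeight_fst hq f c (fun w => w),
    ← weightEntropy_copyWeight_snd hq f c (fun x => x)]
  simp_rw [weightEntropy_eq_neg_sum]
  rw [← neg_add, ← neg_add, ← Finset.sum_add_distrib, ← Finset.sum_add_distrib]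
  congr 1
  refine Finset.sum_congr rfl fun x _ => ?_
  rw [← mul_add, ← mul_add]
  rcases eq_or_ne (copyWeight q f c x) 0 with h | h
  · simp [h]
  · congr 1
    rw [marginal_id, marginal_copyWeight_fst hq, marginal_copyWeight_snd hq,
      marginal_comp _ Prod.fst c, marginal_copyWeight_fst hq]
    have h' := h
    simp only [copyWeight, ne_eq, mul_eq_zero, div_eq_zero_iff, not_or] at h'
    obtain ⟨h1, h2, h3⟩ := h'
    rw [copyWeight, Real.log_mul h1 (div_ne_zero h2 h3), Real.log_div h2 h3]
    ring

/-- A Shannon-type inequality for five variables with `Z` conditionally independent of `(U, V)`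
given `(X, Y)`. -/
lemma weightEntropy_five_variables [Fintype A] [Fintype B] [Fintype C] [Fintype D] [Fintype β]
    {q : W → ℝ} (hq : ∀ w, 0 ≤ q w)
    (X : W → A) (Y : W → B) (U : W → C) (V : W → D) (Z : W → β)
    (hZ : weightEntropy q (fun w => (X w, Y w, U w, V w, Z w)) +
        weightEntropy q (fun w => (X w, Y w)) =
      weightEntropy q (fun w => (X w, Y w, U w, V w)) +
        weightEntropy q (fun w => (X w, Y w, Z w))) :
    2 * (weightEntropy q X + weightEntropy q Y - weightEntropy q (fun w => (X w, Y w))) ≤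
      2 * (weightEntropy q (fun w => (X w, Z w)) + weightEntropy q (fun w => (Y w, Z w)) -
          weightEntropy q (fun w => (X w, Y w, Z w)) - weightEntropy q Z) +
        (weightEntropy q (fun w => (X w, U w)) + weightEntropy q (fun w => (Y w, U w)) -
          weightEntropy q (fun w => (X w, Y w, U w)) - weightEntropy q U) +
        (weightEntropy q (fun w => (X w, V w)) + weightEntropy q (fun w => (Y w, V w)) -
          weightEntropy q (fun w => (X w, Y w, V w)) - weightEntropy q V) +
        (weightEntropy q Z + weightEntropy q (fun w => (X w, Y w)) -
          weightEntropy q (fun w => (X w, Y w, Z w))) +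
        (weightEntropy q U + weightEntropy q V - weightEntropy q (fun w => (U w, V w))) := by
  have i1 := weightEntropy_submodular hq X Y (fun w => (V w, Z w))
    (fun w => (X w, V w, Z w)) (fun w => (Y w, V w, Z w))
    (fun w => (X w, Y w, V w, Z w)) (by grind) (by grind) (by grind)
  have i2 := weightEntropy_submodular hq Z V X
    (fun w => (X w, Z w)) (fun w => (X w, V w))
    (fun w => (X w, V w, Z w)) (by grind) (by grind) (by grind)
  have i3 := weightEntropy_submodular hq Z V Y
    (fun w => (Y w, Z w)) (fun w => (Y w, V w))
    (fun w => (Y w, V w, Z w)) (by grind) (by grind) (by grind)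
  have i4 := weightEntropy_submodular hq X Y (fun w => (U w, Z w))
    (fun w => (X w, U w, Z w)) (fun w => (Y w, U w, Z w))
    (fun w => (X w, Y w, U w, Z w)) (by grind) (by grind) (by grind)
  have i5 := weightEntropy_submodular hq Z U X
    (fun w => (X w, Z w)) (fun w => (X w, U w))
    (fun w => (X w, U w, Z w)) (by grind) (by grind) (by grind)
  have i6 := weightEntropy_submodular hq Z U Y
    (fun w => (Y w, Z w)) (fun w => (Y w, U w))
    (fun w => (Y w, U w, Z w)) (by grind) (by grind) (by grind)
  have i7 := weightEntropy_submodular hq U V Z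
    (fun w => (U w, Z w)) (fun w => (V w, Z w))
    (fun w => (U w, V w, Z w)) (by grind) (by grind) (by grind)
  have i8 := weightEntropy_submodular hq Z (fun w => (X w, Y w)) (fun w => (U w, V w))
    (fun w => (U w, V w, Z w)) (fun w => (X w, Y w, U w, V w))
    (fun w => (X w, Y w, U w, V w, Z w)) (by grind) (by grind) (by grind)
  have i9 := weightEntropy_submodular hq Z V (fun w => (X w, Y w, U w))
    (fun w => (X w, Y w, U w, Z w)) (fun w => (X w, Y w, U w, V w))
    (fun w => (X w, Y w, U w, V w, Z w)) (by grind) (by grind) (by grind)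
  have i10 := weightEntropy_submodular hq Z U (fun w => (X w, Y w, V w))
    (fun w => (X w, Y w, V w, Z w)) (fun w => (X w, Y w, U w, V w))
    (fun w => (X w, Y w, U w, V w, Z w)) (by grind) (by grind) (by grind)
  linarith

/-- The Zhang–Yeung inequality for a weight on a finite product. -/
lemma weightEntropy_zhang_yeung [Fintype A] [Fintype B] [Fintype C] [Fintype D]
    {q : A × B × C × D → ℝ} (hq : ∀ w, 0 ≤ q w) :
    -2 * weightEntropy q (fun w => w.1) - 2 * weightEntropy q (fun w => w.2.1)
      - weightEntropy q (fun w => w.2.2.1)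
      + 3 * weightEntropy q (fun w => (w.1, w.2.1))
      + 3 * weightEntropy q (fun w => (w.1, w.2.2.1))
      + 3 * weightEntropy q (fun w => (w.2.1, w.2.2.1))
      + weightEntropy q (fun w => (w.1, w.2.2.2))
      + weightEntropy q (fun w => (w.2.1, w.2.2.2))
      - weightEntropy q (fun w => (w.2.2.1, w.2.2.2))
      - 4 * weightEntropy q (fun w => (w.1, w.2.1, w.2.2.1))
      - weightEntropy q (fun w => (w.1, w.2.1, w.2.2.2)) ≥ 0 := by
  let f : A × B × C × D → C := fun w => w.2.2.1
  let c : A × B × C × D → A × B := fun w => (w.1, w.2.1)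
  have hid := weightEntropy_copyWeight_id hq f c
  rw [← weightEntropy_copyWeight_fst hq f c c,
    ← weightEntropy_copyWeight_fst hq f c (fun w => w),
    ← weightEntropy_copyWeight_snd hq f c (fun p => p),
    weightEntropy_congr _ (f := fun x => x)
      (g := fun x : (A × B × C × D) × C => (x.1.1, x.1.2.1, x.1.2.2.1, x.1.2.2.2, x.2))
      (by grind),
    weightEntropy_congr _ (f := fun x : (A × B × C × D) × C => (x.2, c x.1))
      (g := fun x => (x.1.1, x.1.2.1, x.2)) (by grind)] at hid
  have key := weightEntropy_five_variables (copyWeight_nonneg hq f c)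
    (fun x => x.1.1) (fun x => x.1.2.1) (fun x => x.1.2.2.1) (fun x => x.1.2.2.2)
    (fun x => x.2) hid
  rw [weightEntropy_copyWeight_fst hq f c (fun w => w.1),
    weightEntropy_copyWeight_fst hq f c (fun w => w.2.1),
    weightEntropy_copyWeight_fst hq f c (fun w => w.2.2.1),
    weightEntropy_copyWeight_fst hq f c (fun w => w.2.2.2),
    weightEntropy_copyWeight_fst hq f c (fun w => (w.1, w.2.1)),
    weightEntropy_copyWeight_fst hq f c (fun w => (w.1, w.2.2.1)),
    weightEntropy_copyWeight_fst hq f c (fun w => (w.2.1, w.2.2.1)),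
    weightEntropy_copyWeight_fst hq f c (fun w => (w.1, w.2.2.2)),
    weightEntropy_copyWeight_fst hq f c (fun w => (w.2.1, w.2.2.2)),
    weightEntropy_copyWeight_fst hq f c (fun w => (w.2.2.1, w.2.2.2)),
    weightEntropy_copyWeight_fst hq f c (fun w => (w.1, w.2.1, w.2.2.1)),
    weightEntropy_copyWeight_fst hq f c (fun w => (w.1, w.2.1, w.2.2.2)),
    weightEntropy_copyWeight_snd hq f c (fun p => p.1),
    weightEntropy_copyWeight_snd hq f c (fun p => (p.2.1, p.1)),
    weightEntropy_copyWeight_snd hq f c (fun p => (p.2.2, p.1)),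
    weightEntropy_copyWeight_snd hq f c (fun p => (p.2.1, p.2.2, p.1))] at key
  dsimp only [f, c] at key
  linarith

end

/-- The entropy of a function of `X` is computed from the distribution of `X`. -/
lemma shannonEntropy_comp_eq_weightEntropy {Ω α β : Type*} [MeasurableSpace Ω] (μ : Measure Ω)
    [IsFiniteMeasure μ] [Fintype α] [MeasurableSpace α] [MeasurableSingletonClass α] [Fintype β]
    {X : Ω → α} (hX : Measurable X) (g : α → β) :
    shannonEntropy μ (fun ω => g (X ω)) = weightEntropy (fun a => μ.real (X ⁻¹' {a})) g := by
  classical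
  refine Finset.sum_congr rfl fun b _ => congrArg Real.negMulLog ?_
  have h := sum_measureReal_preimage_singleton (μ := μ) (f := X)
    (Finset.univ.filter fun a => g a = b) fun a _ => hX (measurableSet_singleton a)
  rw [Finset.sum_filter] at h
  rw [marginal, h, measureReal_def]
  congr 2
  ext ω
  simp

/-- Zhang–Yeung inequality. -/
theorem zhang_yeung_inequality
    {Ω : Type*} [MeasurableSpace Ω] (μ : Measure Ω) [IsProbabilityMeasure μ]
    {α₁ α₂ α₃ α₄ : Type*} [Fintype α₁] [Fintype α₂] [Fintype α₃] [Fintype α₄]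
    [MeasurableSpace α₁] [MeasurableSpace α₂] [MeasurableSpace α₃] [MeasurableSpace α₄]
    [DiscreteMeasurableSpace α₁] [DiscreteMeasurableSpace α₂]
    [DiscreteMeasurableSpace α₃] [DiscreteMeasurableSpace α₄]
    (X₁ : Ω → α₁) (X₂ : Ω → α₂) (X₃ : Ω → α₃) (X₄ : Ω → α₄)
    (hX₁ : Measurable X₁) (hX₂ : Measurable X₂) (hX₃ : Measurable X₃) (hX₄ : Measurable X₄) :
    -2 * shannonEntropy μ X₁ - 2 * shannonEntropy μ X₂ - shannonEntropy μ X₃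
      + 3 * shannonEntropy μ (fun ω => (X₁ ω, X₂ ω))
      + 3 * shannonEntropy μ (fun ω => (X₁ ω, X₃ ω))
      + 3 * shannonEntropy μ (fun ω => (X₂ ω, X₃ ω))
      + shannonEntropy μ (fun ω => (X₁ ω, X₄ ω))
      + shannonEntropy μ (fun ω => (X₂ ω, X₄ ω))
      - shannonEntropy μ (fun ω => (X₃ ω, X₄ ω))
      - 4 * shannonEntropy μ (fun ω => (X₁ ω, X₂ ω, X₃ ω))
      - shannonEntropy μ (fun ω => (X₁ ω, X₂ ω, X₄ ω)) ≥ 0 := by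
  have hX : Measurable fun ω => (X₁ ω, X₂ ω, X₃ ω, X₄ ω) :=
    hX₁.prodMk (hX₂.prodMk (hX₃.prodMk hX₄))
  have key := weightEntropy_zhang_yeung
    (q := fun w => μ.real ((fun ω => (X₁ ω, X₂ ω, X₃ ω, X₄ ω)) ⁻¹' {w})) fun _ => measureReal_nonneg
  rw [← shannonEntropy_comp_eq_weightEntropy μ hX (fun w => w.1),
    ← shannonEntropy_comp_eq_weightEntropy μ hX (fun w => w.2.1),
    ← shannonEntropy_comp_eq_weightEntropy μ hX (fun w => w.2.2.1),
    ← shannonEntropy_comp_eq_weightEntropy μ hX (fun w => (w.1, w.2.1)),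
    ← shannonEntropy_comp_eq_weightEntropy μ hX (fun w => (w.1, w.2.2.1)),
    ← shannonEntropy_comp_eq_weightEntropy μ hX (fun w => (w.2.1, w.2.2.1)),
    ← shannonEntropy_comp_eq_weightEntropy μ hX (fun w => (w.1, w.2.2.2)),
    ← shannonEntropy_comp_eq_weightEntropy μ hX (fun w => (w.2.1, w.2.2.2)),
    ← shannonEntropy_comp_eq_weightEntropy μ hX (fun w => (w.2.2.1, w.2.2.2)),
    ← shannonEntropy_comp_eq_weightEntropy μ hX (fun w => (w.1, w.2.1, w.2.2.1)),
    ← shannonEntropy_comp_eq_weightEntropy μ hX (fun w => (w.1, w.2.1, w.2.2.2))] at key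
  exact key
end

section
/- (New 4-variable non-Shannon-type inequality, the s = 3 instance of the family.) For any four jointly distributed discrete random variables X₁, X₂, X₃, X₄ with finite entropies: −10·H(1) − 10·H(2) − H(3) + 17·H(12) + 10·H(13) + 10·H(23) + 4·H(14) + 4·H(24) − 3·H(34) − 16·H(123) − 5·H(124) ≥ 0. -/
open MeasureTheory

open Classical in
/-- The total weight of the block of the partition `r` containing `ω`. -/
noncomputable def blockMass {Ω : Type*} [Fintype Ω] (q : Ω → ℝ) (r : Setoid Ω) (ω : Ω) : ℝ :=
  ∑ ω', if r ω ω' then q ω' else 0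

/-- The entropy of the partition `r` of a finite set with weights `q`. -/
noncomputable def partEntropy {Ω : Type*} [Fintype Ω] (q : Ω → ℝ) (r : Setoid Ω) : ℝ :=
  -∑ ω, q ω * Real.log (blockMass q r ω)

/-- The conditional mutual information of the partitions `a` and `b` given `c`. -/
noncomputable def condInfo {Ω : Type*} [Fintype Ω] (q : Ω → ℝ) (a b c : Setoid Ω) : ℝ :=
  partEntropy q (a ⊓ c) + partEntropy q (b ⊓ c) - partEntropy q (a ⊓ b ⊓ c) - partEntropy q c

section Partition

variable {Ω : Type*} [Fintype Ω] {q : Ω → ℝ}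

theorem blockMass_nonneg (hq : 0 ≤ q) (r : Setoid Ω) (ω : Ω) : 0 ≤ blockMass q r ω :=
  Finset.sum_nonneg fun ω' _ => by split_ifs <;> [exact hq ω'; exact le_rfl]

theorem le_blockMass (hq : 0 ≤ q) (r : Setoid Ω) (ω : Ω) : q ω ≤ blockMass q r ω := by
  classical
  have h := Finset.single_le_sum (f := fun ω' => if r ω ω' then q ω' else 0)
    (fun ω' _ => by split_ifs <;> [exact hq ω'; exact le_rfl]) (Finset.mem_univ ω)
  simpa [blockMass, r.refl] using h

theorem blockMass_pos (hq : 0 ≤ q) (r : Setoid Ω) {ω : Ω} (h : q ω ≠ 0) : 0 < blockMass q r ω :=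
  ((hq ω).lt_of_ne' h).trans_le (le_blockMass hq r ω)

theorem blockMass_eq_of_rel {r : Setoid Ω} {ω ω' : Ω} (h : r ω ω') :
    blockMass q r ω = blockMass q r ω' := by
  classical
  refine Finset.sum_congr rfl fun x _ => ?_
  have : r ω x ↔ r ω' x := ⟨fun hx => r.trans (r.symm h) hx, fun hx => r.trans h hx⟩
  simp only [this]

theorem blockMass_congr {r s : Setoid Ω} {ω : Ω} (h : ∀ ω', q ω' ≠ 0 → (r ω ω' ↔ s ω ω')) :
    blockMass q r ω = blockMass q s ω := by
  classical
  refine Finset.sum_congr rfl fun x _ => ?_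
  by_cases hx : q x = 0
  · simp [hx]
  · simp only [h x hx]

theorem partEntropy_congr {r s : Setoid Ω}
    (h : ∀ ω ω', q ω ≠ 0 → q ω' ≠ 0 → (r ω ω' ↔ s ω ω')) :
    partEntropy q r = partEntropy q s := by
  unfold partEntropy
  congr 1
  refine Finset.sum_congr rfl fun ω _ => ?_
  by_cases hω : q ω = 0
  · simp [hω]
  · rw [blockMass_congr fun ω' => h ω ω' hω]

/-- Normalizing the weights by block masses gives every block total weight at most one. -/
theorem sum_div_blockMass_le_one (hq : 0 ≤ q) (r : Setoid Ω) (p : Ω → Prop)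
    [DecidablePred p] (hp : ∀ ω ω', p ω → p ω' → r ω ω') :
    ∑ ω, (if p ω then q ω / blockMass q r ω else 0) ≤ 1 := by
  classical
  by_cases h : ∃ ω₀, p ω₀
  · obtain ⟨ω₀, h₀⟩ := h
    calc ∑ ω, (if p ω then q ω / blockMass q r ω else 0)
        ≤ ∑ ω, (if r ω₀ ω then q ω else 0) / blockMass q r ω₀ := by
          refine Finset.sum_le_sum fun ω _ => ?_
          by_cases hω : p ω
          · have hr := hp _ _ h₀ hω
            simp [hω, hr, blockMass_eq_of_rel hr]
          · rw [if_neg hω]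
            refine div_nonneg ?_ (blockMass_nonneg hq r ω₀)
            split_ifs <;> [exact hq ω; exact le_rfl]
      _ = blockMass q r ω₀ / blockMass q r ω₀ := by rw [← Finset.sum_div]; rfl
      _ ≤ 1 := div_self_le_one _
  · push Not at h
    simp [h]

open Classical in
theorem sum_mul_div_blockMass_le (hq : 0 ≤ q) (a b c : Setoid Ω) :
    ∑ ω, q ω * (blockMass q (a ⊓ c) ω * blockMass q (b ⊓ c) ω /
      (blockMass q (a ⊓ b ⊓ c) ω * blockMass q c ω)) ≤ ∑ ω, q ω := by
  calc ∑ ω, q ω * (blockMass q (a ⊓ c) ω * blockMass q (b ⊓ c) ω /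
          (blockMass q (a ⊓ b ⊓ c) ω * blockMass q c ω))
      = ∑ ω, ∑ x, ∑ y, (if c x y then q x * q y / blockMass q c x else 0) *
          (if (a ⊓ c) ω x ∧ (b ⊓ c) ω y then q ω / blockMass q (a ⊓ b ⊓ c) ω else 0) := by
        refine Finset.sum_congr rfl fun ω _ => ?_
        have h : blockMass q (a ⊓ c) ω * blockMass q (b ⊓ c) ω =
            ∑ x, ∑ y, (if (a ⊓ c) ω x then q x else 0) * (if (b ⊓ c) ω y then q y else 0) :=
          Finset.sum_mul_sum ..
        rw [h, Finset.sum_div, Finset.mul_sum]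
        refine Finset.sum_congr rfl fun x _ => ?_
        rw [Finset.sum_div, Finset.mul_sum]
        refine Finset.sum_congr rfl fun y _ => ?_
        by_cases hx : (a ⊓ c) ω x
        · by_cases hy : (b ⊓ c) ω y
          · have hxy : c x y := c.trans (c.symm hx.2) hy.2
            rw [if_pos hx, if_pos hy, if_pos hxy, if_pos ⟨hx, hy⟩, blockMass_eq_of_rel hx.2]
            ring
          · simp [hy]
        · simp [hx]
    _ = ∑ x, ∑ y, (if c x y then q x * q y / blockMass q c x else 0) *
          ∑ ω, (if (a ⊓ c) ω x ∧ (b ⊓ c) ω y then q ω / blockMass q (a ⊓ b ⊓ c) ω else 0) := by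
        rw [Finset.sum_comm]
        refine Finset.sum_congr rfl fun x _ => ?_
        rw [Finset.sum_comm]
        simp only [Finset.mul_sum]
    _ ≤ ∑ x, ∑ y, (if c x y then q x * q y / blockMass q c x else 0) := by
        refine Finset.sum_le_sum fun x _ => Finset.sum_le_sum fun y _ => ?_
        refine mul_le_of_le_one_right ?_ (sum_div_blockMass_le_one hq _ _ ?_)
        · split_ifs
          · exact div_nonneg (mul_nonneg (hq x) (hq y)) (blockMass_nonneg hq c x)
          · exact le_rfl
        · rintro ω ω' ⟨h₁, h₂⟩ ⟨h₁', h₂'⟩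
          exact ⟨⟨a.trans h₁.1 (a.symm h₁'.1), b.trans h₂.1 (b.symm h₂'.1)⟩,
            c.trans h₁.2 (c.symm h₁'.2)⟩
    _ = ∑ x, q x / blockMass q c x * blockMass q c x := by
        refine Finset.sum_congr rfl fun x _ => ?_
        rw [blockMass, Finset.mul_sum]
        refine Finset.sum_congr rfl fun y _ => ?_
        split_ifs <;> ring
    _ ≤ ∑ x, q x := by
        refine Finset.sum_le_sum fun x _ => ?_
        by_cases hx : q x = 0
        · simp [hx]
        · rw [div_mul_cancel₀ _ (blockMass_pos hq c hx).ne']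

theorem condInfo_nonneg (hq : 0 ≤ q) (a b c : Setoid Ω) : 0 ≤ condInfo q a b c := by
  have key : condInfo q a b c = ∑ ω, q ω *
      (Real.log (blockMass q (a ⊓ b ⊓ c) ω) + Real.log (blockMass q c ω)
        - Real.log (blockMass q (a ⊓ c) ω) - Real.log (blockMass q (b ⊓ c) ω)) := by
    simp only [condInfo, partEntropy, mul_sub, mul_add, Finset.sum_sub_distrib,
      Finset.sum_add_distrib]
    ring
  rw [key]
  calc (0 : ℝ) ≤ ∑ ω, (q ω - q ω * (blockMass q (a ⊓ c) ω * blockMass q (b ⊓ c) ω /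
          (blockMass q (a ⊓ b ⊓ c) ω * blockMass q c ω))) := by
        rw [Finset.sum_sub_distrib]
        exact sub_nonneg.2 (sum_mul_div_blockMass_le hq a b c)
    _ ≤ _ := by
        refine Finset.sum_le_sum fun ω _ => ?_
        by_cases hω : q ω = 0
        · simp [hω]
        have h₁ := blockMass_pos hq (a ⊓ c) hω
        have h₂ := blockMass_pos hq (b ⊓ c) hω
        have h₃ := blockMass_pos hq (a ⊓ b ⊓ c) hω
        have h₄ := blockMass_pos hq c hω
        have h := Real.log_le_sub_one_of_pos (div_pos (mul_pos h₁ h₂) (mul_pos h₃ h₄))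
        rw [Real.log_div (mul_pos h₁ h₂).ne' (mul_pos h₃ h₄).ne', Real.log_mul h₁.ne' h₂.ne',
          Real.log_mul h₃.ne' h₄.ne'] at h
        rw [← mul_one_sub]
        exact mul_le_mul_of_nonneg_left (by linarith) (hq ω)

/-- The Ingleton expression of four partitions, with `a` and `b` in the distinguished role. -/
noncomputable def ingleton (q : Ω → ℝ) (a b c d : Setoid Ω) : ℝ :=
  condInfo q a b c + condInfo q a b d + condInfo q c d ⊤ - condInfo q a b ⊤

/-- A Shannon-type bound on the Ingleton expression by means of a partition `w` which is
conditionally independent of `c ⊓ d` given `a ⊓ b`. -/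
theorem condInfo_le_ingleton_add (hq : 0 ≤ q) {a b c d w : Setoid Ω}
    (h : condInfo q w (c ⊓ d) (a ⊓ b) = 0) :
    condInfo q a b (c ⊓ w) ≤ ingleton q a b c d
      + condInfo q a b w + condInfo q a w b + condInfo q b w a := by
  have h₁ := condInfo_nonneg hq c d w
  have h₂ := condInfo_nonneg hq a b (d ⊓ w)
  have h₃ := condInfo_nonneg hq c w a
  have h₄ := condInfo_nonneg hq c w b
  have h₅ := condInfo_nonneg hq d w a
  have h₆ := condInfo_nonneg hq d w b
  have h₇ := condInfo_nonneg hq (a ⊓ b) w (c ⊓ d)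
  have h₈ := condInfo_nonneg hq c w (a ⊓ b ⊓ d)
  have h₉ := condInfo_nonneg hq d w (a ⊓ b ⊓ c)
  simp only [ingleton, condInfo, inf_top_eq, inf_comm, inf_left_comm] at *
  linarith

end Partition

section Copy

variable {Ω : Type*} [Fintype Ω] {q : Ω → ℝ}

open Classical in
/-- The weights on `Ω × Ω` making the two coordinates distributed according to `q`,
in the same block of `z`, and conditionally independent given that block. -/
noncomputable def condCopy (q : Ω → ℝ) (z : Setoid Ω) (p : Ω × Ω) : ℝ :=
  if z p.1 p.2 then q p.1 * q p.2 / blockMass q z p.1 else 0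

theorem condCopy_nonneg (hq : 0 ≤ q) (z : Setoid Ω) : 0 ≤ condCopy q z := by
  intro p
  unfold condCopy
  split_ifs
  · exact div_nonneg (mul_nonneg (hq _) (hq _)) (blockMass_nonneg hq _ _)
  · exact le_rfl

theorem condCopy_ne_zero {z : Setoid Ω} {p : Ω × Ω} (h : condCopy q z p ≠ 0) :
    z p.1 p.2 ∧ q p.1 ≠ 0 ∧ q p.2 ≠ 0 := by
  unfold condCopy at h
  split_ifs at h with hz
  · refine ⟨hz, ?_, ?_⟩ <;> · intro h₀; simp [h₀] at h
  · exact absurd rfl h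

theorem condCopy_swap (z : Setoid Ω) (x y : Ω) : condCopy q z (x, y) = condCopy q z (y, x) := by
  unfold condCopy
  by_cases h : z x y
  · rw [if_pos h, if_pos (z.symm h), blockMass_eq_of_rel h, mul_comm (q x)]
  · rw [if_neg h, if_neg fun h' => h (z.symm h')]

theorem sum_condCopy_right (hq : 0 ≤ q) (z : Setoid Ω) (x : Ω) :
    ∑ y, condCopy q z (x, y) = q x := by
  classical
  have : ∑ y, condCopy q z (x, y) = q x / blockMass q z x * blockMass q z x := by
    rw [blockMass, Finset.mul_sum]
    refine Finset.sum_congr rfl fun y _ => ?_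
    unfold condCopy
    split_ifs <;> simp [blockMass]
    ring
  rw [this]
  by_cases hx : q x = 0
  · simp [hx]
  · rw [div_mul_cancel₀ _ (blockMass_pos hq z hx).ne']

theorem sum_condCopy_mul_fst (hq : 0 ≤ q) (z : Setoid Ω) (f : Ω → ℝ) :
    ∑ p, condCopy q z p * f p.1 = ∑ x, q x * f x := by
  simp only [Fintype.sum_prod_type, ← Finset.sum_mul, sum_condCopy_right hq]

theorem sum_condCopy_mul_snd (hq : 0 ≤ q) (z : Setoid Ω) (f : Ω → ℝ) :
    ∑ p, condCopy q z p * f p.2 = ∑ x, q x * f x := by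
  simp only [Fintype.sum_prod_type_right, ← Finset.sum_mul, condCopy_swap z _,
    sum_condCopy_right hq]

theorem partEntropy_condCopy_fst (hq : 0 ≤ q) (z r : Setoid Ω) :
    partEntropy (condCopy q z) (r.comap Prod.fst) = partEntropy q r := by
  classical
  have h (p : Ω × Ω) : blockMass (condCopy q z) (r.comap Prod.fst) p = blockMass q r p.1 := by
    have := sum_condCopy_mul_fst hq z fun x => if r p.1 x then 1 else 0
    simpa [blockMass, Setoid.comap_rel] using this
  simp only [partEntropy, h, sum_condCopy_mul_fst hq z fun x => Real.log (blockMass q r x)]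

theorem partEntropy_condCopy_snd (hq : 0 ≤ q) (z r : Setoid Ω) :
    partEntropy (condCopy q z) (r.comap Prod.snd) = partEntropy q r := by
  classical
  have h (p : Ω × Ω) : blockMass (condCopy q z) (r.comap Prod.snd) p = blockMass q r p.2 := by
    have := sum_condCopy_mul_snd hq z fun x => if r p.2 x then 1 else 0
    simpa [blockMass, Setoid.comap_rel] using this
  simp only [partEntropy, h, sum_condCopy_mul_snd hq z fun x => Real.log (blockMass q r x)]

/-- A partition coarser than `z` may be read off from either coordinate. -/
theorem partEntropy_condCopy_of_le (hq : 0 ≤ q) {z r : Setoid Ω} (hr : z ≤ r) (y : Setoid Ω) :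
    partEntropy (condCopy q z) (r.comap Prod.fst ⊓ y.comap Prod.snd) = partEntropy q (r ⊓ y) := by
  rw [← partEntropy_condCopy_snd hq z (r ⊓ y)]
  refine partEntropy_congr fun p p' hp hp' => ?_
  have h₁ := hr (condCopy_ne_zero hp).1
  have h₂ := hr (condCopy_ne_zero hp').1
  have : r p.1 p'.1 ↔ r p.2 p'.2 :=
    ⟨fun h => r.trans (r.symm h₁) (r.trans h h₂), fun h => r.trans h₁ (r.trans h (r.symm h₂))⟩
  exact and_congr_left' this

theorem blockMass_condCopy {x y z : Setoid Ω} (hx : x ≤ z) (hy : y ≤ z) {p : Ω × Ω}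
    (hp : z p.1 p.2) :
    blockMass (condCopy q z) (x.comap Prod.fst ⊓ y.comap Prod.snd) p =
      blockMass q x p.1 * blockMass q y p.2 / blockMass q z p.1 := by
  classical
  have h : blockMass q x p.1 * blockMass q y p.2 =
      ∑ u, ∑ v, (if x p.1 u then q u else 0) * (if y p.2 v then q v else 0) :=
    Finset.sum_mul_sum ..
  rw [h, blockMass, Fintype.sum_prod_type, Finset.sum_div]
  refine Finset.sum_congr rfl fun u _ => ?_
  rw [Finset.sum_div]
  refine Finset.sum_congr rfl fun v _ => ?_
  have hrel : (x.comap Prod.fst ⊓ y.comap Prod.snd) p (u, v) ↔ x p.1 u ∧ y p.2 v := Iff.rfl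
  by_cases hu : x p.1 u
  · by_cases hv : y p.2 v
    · have huv : z u v := z.trans (z.symm (hx hu)) (z.trans hp (hy hv))
      rw [if_pos (hrel.2 ⟨hu, hv⟩), if_pos hu, if_pos hv, condCopy, if_pos huv,
        blockMass_eq_of_rel (hx hu)]
    · rw [if_neg fun h => hv (hrel.1 h).2, if_neg hv]
      simp
  · rw [if_neg fun h => hu (hrel.1 h).1, if_neg hu]
    simp

theorem partEntropy_condCopy_of_le_of_le (hq : 0 ≤ q) {x y z : Setoid Ω}
    (hx : x ≤ z) (hy : y ≤ z) :
    partEntropy (condCopy q z) (x.comap Prod.fst ⊓ y.comap Prod.snd) =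
      partEntropy q x + partEntropy q y - partEntropy q z := by
  have h (p : Ω × Ω) : condCopy q z p *
        Real.log (blockMass (condCopy q z) (x.comap Prod.fst ⊓ y.comap Prod.snd) p) =
      condCopy q z p * Real.log (blockMass q x p.1) + condCopy q z p * Real.log (blockMass q y p.2)
        - condCopy q z p * Real.log (blockMass q z p.1) := by
    by_cases hp : condCopy q z p = 0
    · simp [hp]
    obtain ⟨hz, h₁, h₂⟩ := condCopy_ne_zero hp
    have hx₁ := (blockMass_pos hq x h₁).ne'
    have hy₂ := (blockMass_pos hq y h₂).ne'
    rw [blockMass_condCopy hx hy hz, Real.log_div (mul_ne_zero hx₁ hy₂) (blockMass_pos hq z h₁).ne',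
      Real.log_mul hx₁ hy₂]
    ring
  simp only [partEntropy, h, Finset.sum_sub_distrib, Finset.sum_add_distrib,
    sum_condCopy_mul_fst hq z fun u => Real.log (blockMass q x u),
    sum_condCopy_mul_fst hq z fun u => Real.log (blockMass q z u),
    sum_condCopy_mul_snd hq z fun u => Real.log (blockMass q y u)]
  ring

/-- In the conditional copy, the second coordinate is independent of the first given `z`. -/
theorem partEntropy_condCopy (hq : 0 ≤ q) {x z : Setoid Ω} (hx : x ≤ z) (y : Setoid Ω) :
    partEntropy (condCopy q z) (x.comap Prod.fst ⊓ y.comap Prod.snd) =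
      partEntropy q x + partEntropy q (y ⊓ z) - partEntropy q z := by
  rw [← partEntropy_condCopy_of_le_of_le hq hx inf_le_right]
  refine partEntropy_congr fun p p' hp hp' => ?_
  refine and_congr_right fun h => ⟨fun hy => ⟨hy, ?_⟩, fun hy => hy.1⟩
  exact z.trans (z.symm (condCopy_ne_zero hp).1) (z.trans (hx h) (condCopy_ne_zero hp').1)

theorem condInfo_comap {Ω' : Type*} [Fintype Ω'] {q' : Ω' → ℝ} {π : Ω' → Ω}
    (h : ∀ r : Setoid Ω, partEntropy q' (r.comap π) = partEntropy q r) (a b c : Setoid Ω) :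
    condInfo q' (a.comap π) (b.comap π) (c.comap π) = condInfo q a b c := by
  have hinf (r t : Setoid Ω) : r.comap π ⊓ t.comap π = (r ⊓ t).comap π := rfl
  simp only [condInfo, hinf, h]

theorem ingleton_comap {Ω' : Type*} [Fintype Ω'] {q' : Ω' → ℝ} {π : Ω' → Ω}
    (h : ∀ r : Setoid Ω, partEntropy q' (r.comap π) = partEntropy q r) (a b c d : Setoid Ω) :
    ingleton q' (a.comap π) (b.comap π) (c.comap π) (d.comap π) = ingleton q a b c d := by
  have htop : (⊤ : Setoid Ω') = (⊤ : Setoid Ω).comap π := rfl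
  simp only [ingleton, htop, condInfo_comap h]

theorem condInfo_inf_le (hq : 0 ≤ q) {a b c d w : Setoid Ω}
    (h : condInfo q w (c ⊓ d) (a ⊓ b) = 0) :
    condInfo q a (w ⊓ c) b ≤ condInfo q a w b + condInfo q a c b := by
  have h₁ := condInfo_nonneg hq w d (a ⊓ b ⊓ c)
  have h₂ := condInfo_nonneg hq w c b
  simp only [condInfo, inf_comm, inf_left_comm] at *
  linarith

section

variable {a b c w : Setoid Ω}

theorem partEntropy_condCopy_inf (hq : 0 ≤ q) {r : Setoid Ω} (hr : a ⊓ b ≤ r) :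
    partEntropy (condCopy q (a ⊓ b ⊓ w))
        (r.comap Prod.fst ⊓ (w.comap Prod.fst ⊓ c.comap Prod.snd)) =
      partEntropy q (r ⊓ (w ⊓ c)) := by
  rw [← inf_assoc, ← inf_assoc]
  exact partEntropy_condCopy_of_le hq (inf_le_inf_right w hr) c

theorem condInfo_condCopy_given (hq : 0 ≤ q) :
    condInfo (condCopy q (a ⊓ b ⊓ w)) (a.comap Prod.fst) (b.comap Prod.fst)
        (w.comap Prod.fst ⊓ c.comap Prod.snd) = condInfo q a b (w ⊓ c) := by
  have h : partEntropy (condCopy q (a ⊓ b ⊓ w)) (w.comap Prod.fst ⊓ c.comap Prod.snd) =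
      partEntropy q (w ⊓ c) := partEntropy_condCopy_of_le hq inf_le_right c
  have hab : a.comap Prod.fst ⊓ b.comap Prod.fst = (a ⊓ b).comap (Prod.fst : Ω × Ω → Ω) := rfl
  rw [condInfo, hab, partEntropy_condCopy_inf hq inf_le_left,
    partEntropy_condCopy_inf hq inf_le_right, partEntropy_condCopy_inf hq le_rfl, h, condInfo]

theorem condInfo_condCopy_left (hq : 0 ≤ q) :
    condInfo (condCopy q (a ⊓ b ⊓ w)) (a.comap Prod.fst)
        (w.comap Prod.fst ⊓ c.comap Prod.snd) (b.comap Prod.fst) = condInfo q a (w ⊓ c) b := by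
  have hab : a.comap Prod.fst ⊓ b.comap Prod.fst = (a ⊓ b).comap (Prod.fst : Ω × Ω → Ω) := rfl
  rw [condInfo, inf_right_comm (a.comap (Prod.fst : Ω × Ω → Ω)), hab,
    inf_comm (w.comap Prod.fst ⊓ c.comap Prod.snd) (b.comap Prod.fst), partEntropy_condCopy_fst hq,
    partEntropy_condCopy_fst hq, partEntropy_condCopy_inf hq inf_le_right,
    partEntropy_condCopy_inf hq le_rfl, condInfo, inf_right_comm a, inf_comm (w ⊓ c) b]

theorem condInfo_condCopy_inf (hq : 0 ≤ q) (d : Setoid Ω) :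
    condInfo (condCopy q (a ⊓ b ⊓ w)) (w.comap Prod.fst ⊓ c.comap Prod.snd)
        ((c ⊓ d).comap Prod.fst) ((a ⊓ b).comap Prod.fst) = condInfo q w (c ⊓ d) (a ⊓ b) := by
  have h : partEntropy (condCopy q (a ⊓ b ⊓ w))
      ((w ⊓ (c ⊓ d) ⊓ (a ⊓ b)).comap Prod.fst ⊓ c.comap Prod.snd) =
      partEntropy q (w ⊓ (c ⊓ d) ⊓ (a ⊓ b)) + partEntropy q (c ⊓ (a ⊓ b ⊓ w))
        - partEntropy q (a ⊓ b ⊓ w) :=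
    partEntropy_condCopy hq (le_inf inf_le_right (inf_le_left.trans inf_le_left)) c
  have hcd : (c ⊓ d).comap Prod.fst ⊓ (a ⊓ b).comap Prod.fst =
    (c ⊓ d ⊓ (a ⊓ b)).comap (Prod.fst : Ω × Ω → Ω) := rfl
  have hjoint : w.comap Prod.fst ⊓ c.comap Prod.snd ⊓ (c ⊓ d).comap Prod.fst ⊓
      (a ⊓ b).comap Prod.fst =
      (w ⊓ (c ⊓ d) ⊓ (a ⊓ b)).comap (Prod.fst : Ω × Ω → Ω) ⊓ c.comap Prod.snd := by
    rw [inf_right_comm (w.comap _), inf_right_comm _ (c.comap _)]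
    rfl
  rw [condInfo, hjoint, hcd, h, inf_comm _ ((a ⊓ b).comap _), partEntropy_condCopy_inf hq le_rfl,
    partEntropy_condCopy_fst hq, partEntropy_condCopy_fst hq, condInfo, inf_comm w (a ⊓ b),
    inf_comm c (a ⊓ b ⊓ w), inf_assoc (a ⊓ b) w c]
  ring

end

/-- Adjoining a conditional copy of `c` to `w` improves the lower bound on the Ingleton
expression. -/
theorem exists_copy_step (hq : 0 ≤ q) {a b c d w : Setoid Ω}
    (h : condInfo q w (c ⊓ d) (a ⊓ b) = 0) :
    ∃ (q' : Ω × Ω → ℝ) (w' : Setoid (Ω × Ω)), 0 ≤ q' ∧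
      (∀ r : Setoid Ω, partEntropy q' (r.comap Prod.fst) = partEntropy q r) ∧
      condInfo q' w' ((c ⊓ d).comap Prod.fst) ((a ⊓ b).comap Prod.fst) = 0 ∧
      condInfo q' (a.comap Prod.fst) w' (b.comap Prod.fst) ≤
        condInfo q a w b + condInfo q a c b ∧
      condInfo q' (b.comap Prod.fst) w' (a.comap Prod.fst) ≤
        condInfo q b w a + condInfo q b c a ∧
      condInfo q' (a.comap Prod.fst) (b.comap Prod.fst) (c.comap Prod.fst ⊓ w') ≤
        ingleton q a b c d + condInfo q a b (c ⊓ w) + (condInfo q a w b + condInfo q a c b) +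
          (condInfo q b w a + condInfo q b c a) := by
  have hind := (condInfo_condCopy_inf (a := a) (b := b) (c := c) (w := w) hq d).trans h
  have ha := condInfo_condCopy_left (a := a) (b := b) (c := c) (w := w) hq
  have hb := condInfo_condCopy_left (a := b) (b := a) (c := c) (w := w) hq
  rw [inf_comm b a] at hb
  have hab := condInfo_condCopy_given (a := a) (b := b) (c := c) (w := w) hq
  have hing := condInfo_le_ingleton_add (q := condCopy q (a ⊓ b ⊓ w)) (a := a.comap Prod.fst)
    (b := b.comap Prod.fst) (c := c.comap Prod.fst) (d := d.comap Prod.fst)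
    (w := w.comap Prod.fst ⊓ c.comap Prod.snd) (condCopy_nonneg hq _) hind
  rw [ingleton_comap (partEntropy_condCopy_fst hq _), ha, hb, hab, inf_comm w c] at hing
  have ha' := condInfo_inf_le hq h
  have hb' := condInfo_inf_le hq (inf_comm a b ▸ h)
  rw [inf_comm w c] at ha' hb' ha hb
  exact ⟨condCopy q (a ⊓ b ⊓ w), w.comap Prod.fst ⊓ c.comap Prod.snd, condCopy_nonneg hq _,
    partEntropy_condCopy_fst hq _, hind, ha.trans_le ha', hb.trans_le hb', by linarith⟩

end Copy

/-- The `s`-fold iterated copy construction: after passing to an extension of the weighted set,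
there is a partition `w`, conditionally independent of `c ⊓ d` given `a ⊓ b`, which bounds `s`
times the Ingleton expression from below. -/
theorem exists_iterated_copy.{u} {Ω : Type u} [Fintype Ω] {q : Ω → ℝ} (hq : 0 ≤ q)
    (a b c d : Setoid Ω) (s : ℕ) :
    ∃ (Ω' : Type u) (_ : Fintype Ω') (q' : Ω' → ℝ) (π : Ω' → Ω) (w : Setoid Ω'), 0 ≤ q' ∧
      (∀ r : Setoid Ω, partEntropy q' (r.comap π) = partEntropy q r) ∧
      condInfo q' w ((c ⊓ d).comap π) ((a ⊓ b).comap π) = 0 ∧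
      condInfo q' (a.comap π) w (b.comap π) ≤ s * condInfo q a c b ∧
      condInfo q' (b.comap π) w (a.comap π) ≤ s * condInfo q b c a ∧
      condInfo q' (a.comap π) (b.comap π) (c.comap π ⊓ w) ≤ s * ingleton q a b c d +
        condInfo q a b c + s * (s + 1) / 2 * (condInfo q a c b + condInfo q b c a) := by
  induction s with
  | zero =>
    refine ⟨Ω, inferInstance, q, id, ⊤, hq, fun _ => rfl, ?_⟩
    have h (r : Setoid Ω) : r.comap id = r := rfl
    simp [h, condInfo]
  | succ s ih =>
    obtain ⟨Ω', _, q', π, w, hq', hlaw, hind, ha, hb, hing⟩ := ih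
    have hind₀ : condInfo q' w (c.comap π ⊓ d.comap π) (a.comap π ⊓ b.comap π) = 0 := hind
    obtain ⟨q'', w', hq'', hlaw', hind', ha', hb', hing'⟩ := exists_copy_step hq' hind₀
    rw [condInfo_comap hlaw] at ha' hb'
    rw [condInfo_comap hlaw, condInfo_comap hlaw, ingleton_comap hlaw] at hing'
    refine ⟨Ω' × Ω', inferInstance, q'', π ∘ Prod.fst, w', hq'', fun r => ?_, hind', ?_, ?_, ?_⟩
    · exact (hlaw' (r.comap π)).trans (hlaw r)
    · refine ha'.trans ?_
      push_cast
      linarith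
    · refine hb'.trans ?_
      push_cast
      linarith
    · refine hing'.trans ?_
      push_cast
      linarith

theorem Setoid.ker_prodMk {α β γ : Type*} (f : α → β) (g : α → γ) :
    Setoid.ker (fun x => (f x, g x)) = Setoid.ker f ⊓ Setoid.ker g :=
  Setoid.ext fun _ _ => Prod.mk_inj

/-- The entropy of a function of a random variable `T` is the entropy of the partition into its
fibers, weighted by the distribution of `T`. -/
theorem shannonEntropy_comp {Ω : Type*} [MeasurableSpace Ω] (μ : Measure Ω) [IsFiniteMeasure μ]
    {α β : Type*} [Fintype α] [Fintype β] {T : Ω → α} (hT : ∀ x, MeasurableSet (T ⁻¹' {x}))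
    (f : α → β) :
    shannonEntropy μ (fun ω => f (T ω)) =
      partEntropy (fun x => μ.real (T ⁻¹' {x})) (Setoid.ker f) := by
  classical
  have hfiber (b : β) : (μ ((fun ω => f (T ω)) ⁻¹' {b})).toReal =
      ∑ x with f x = b, μ.real (T ⁻¹' {x}) := by
    rw [sum_measureReal_preimage_singleton _ fun x _ => hT x]
    congr 2
    ext ω
    simp
  have hblock (x : α) : blockMass (fun x => μ.real (T ⁻¹' {x})) (Setoid.ker f) x =
      (μ ((fun ω => f (T ω)) ⁻¹' {f x})).toReal := by
    rw [hfiber, Finset.sum_filter, blockMass]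
    refine Finset.sum_congr rfl fun y _ => ?_
    simp only [Setoid.ker_def, eq_comm]
  simp only [shannonEntropy, partEntropy, hblock, Real.negMulLog]
  rw [← Finset.sum_fiberwise _ f, ← Finset.sum_neg_distrib]
  refine Finset.sum_congr rfl fun b _ => ?_
  rw [neg_mul, neg_inj]
  nth_rw 1 [hfiber]
  rw [Finset.sum_mul]
  refine Finset.sum_congr rfl fun x hx => ?_
  rw [(Finset.mem_filter.1 hx).2]

theorem nonneg_mul_ingleton_add {Ω : Type*} [Fintype Ω] {q : Ω → ℝ} (hq : 0 ≤ q)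
    (a b c d : Setoid Ω) (s : ℕ) :
    0 ≤ s * ingleton q a b c d + condInfo q a b c +
      s * (s + 1) / 2 * (condInfo q a c b + condInfo q b c a) := by
  obtain ⟨Ω', _, q', π, w, hq', -, -, -, -, h⟩ := exists_iterated_copy hq a b c d s
  exact (condInfo_nonneg hq' _ _ _).trans h

theorem partEntropy_four_partitions {Ω : Type*} [Fintype Ω] {q : Ω → ℝ} (hq : 0 ≤ q)
    (a b c d : Setoid Ω) :
    -10 * partEntropy q a - 10 * partEntropy q b - partEntropy q c + 17 * partEntropy q (a ⊓ b)
      + 10 * partEntropy q (a ⊓ c) + 10 * partEntropy q (b ⊓ c) + 4 * partEntropy q (a ⊓ d)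
      + 4 * partEntropy q (b ⊓ d) - 3 * partEntropy q (c ⊓ d) - 16 * partEntropy q (a ⊓ (b ⊓ c))
      - 5 * partEntropy q (a ⊓ (b ⊓ d)) ≥ 0 := by
  have hmain := nonneg_mul_ingleton_add hq a b c d 3
  have had := condInfo_nonneg hq a d b
  have hbd := condInfo_nonneg hq b d a
  simp only [ingleton, condInfo, inf_top_eq, inf_comm, inf_left_comm] at *
  push_cast at hmain
  linarith

theorem new_four_variable_inequality_s3
    {Ω : Type*} [MeasurableSpace Ω] (μ : Measure Ω) [IsProbabilityMeasure μ]
    {α₁ α₂ α₃ α₄ : Type*} [Fintype α₁] [Fintype α₂] [Fintype α₃] [Fintype α₄]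
    [MeasurableSpace α₁] [MeasurableSpace α₂] [MeasurableSpace α₃] [MeasurableSpace α₄]
    [DiscreteMeasurableSpace α₁] [DiscreteMeasurableSpace α₂]
    [DiscreteMeasurableSpace α₃] [DiscreteMeasurableSpace α₄]
    (X₁ : Ω → α₁) (X₂ : Ω → α₂) (X₃ : Ω → α₃) (X₄ : Ω → α₄)
    (hX₁ : Measurable X₁) (hX₂ : Measurable X₂) (hX₃ : Measurable X₃) (hX₄ : Measurable X₄) :
    -10 * shannonEntropy μ X₁
      - 10 * shannonEntropy μ X₂
      - shannonEntropy μ X₃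
      + 17 * shannonEntropy μ (fun ω => (X₁ ω, X₂ ω))
      + 10 * shannonEntropy μ (fun ω => (X₁ ω, X₃ ω))
      + 10 * shannonEntropy μ (fun ω => (X₂ ω, X₃ ω))
      + 4 * shannonEntropy μ (fun ω => (X₁ ω, X₄ ω))
      + 4 * shannonEntropy μ (fun ω => (X₂ ω, X₄ ω))
      - 3 * shannonEntropy μ (fun ω => (X₃ ω, X₄ ω))
      - 16 * shannonEntropy μ (fun ω => (X₁ ω, X₂ ω, X₃ ω))
      - 5 * shannonEntropy μ (fun ω => (X₁ ω, X₂ ω, X₄ ω)) ≥ 0 := by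
  let T : Ω → α₁ × α₂ × α₃ × α₄ := fun ω => (X₁ ω, X₂ ω, X₃ ω, X₄ ω)
  have hT (x) : MeasurableSet (T ⁻¹' {x}) := by
    have hx : T ⁻¹' {x} =
        X₁ ⁻¹' {x.1} ∩ (X₂ ⁻¹' {x.2.1} ∩ (X₃ ⁻¹' {x.2.2.1} ∩ X₄ ⁻¹' {x.2.2.2})) := by
      ext ω
      simp [T, Prod.ext_iff]
    rw [hx]
    exact (hX₁ .of_discrete).inter <| (hX₂ .of_discrete).inter <|
      (hX₃ .of_discrete).inter (hX₄ .of_discrete)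
  have hq : 0 ≤ fun x => μ.real (T ⁻¹' {x}) := fun _ => measureReal_nonneg
  have h₁ := shannonEntropy_comp μ hT fun x => x.1
  have h₂ := shannonEntropy_comp μ hT fun x => x.2.1
  have h₃ := shannonEntropy_comp μ hT fun x => x.2.2.1
  have h₁₂ := shannonEntropy_comp μ hT fun x => (x.1, x.2.1)
  have h₁₃ := shannonEntropy_comp μ hT fun x => (x.1, x.2.2.1)
  have h₂₃ := shannonEntropy_comp μ hT fun x => (x.2.1, x.2.2.1)
  have h₁₄ := shannonEntropy_comp μ hT fun x => (x.1, x.2.2.2)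
  have h₂₄ := shannonEntropy_comp μ hT fun x => (x.2.1, x.2.2.2)
  have h₃₄ := shannonEntropy_comp μ hT fun x => (x.2.2.1, x.2.2.2)
  have h₁₂₃ := shannonEntropy_comp μ hT fun x => (x.1, x.2.1, x.2.2.1)
  have h₁₂₄ := shannonEntropy_comp μ hT fun x => (x.1, x.2.1, x.2.2.2)
  simp only [Setoid.ker_prodMk] at h₁₂ h₁₃ h₂₃ h₁₄ h₂₄ h₃₄ h₁₂₃ h₁₂₄
  rw [h₁, h₂, h₃, h₁₂, h₁₃, h₂₃, h₁₄, h₂₄, h₃₄, h₁₂₃, h₁₂₄]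
  exact partEntropy_four_partitions hq _ _ _ _
end
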